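/- If t is a normal closed term of star type in the star combinatory calculus, then t is set-like, i.e. t is constructed solely from terms of the form 𝔰q and the constant ∪ (t is either 𝔰q for some term q, or ∪ t₁ t₂ for set-like terms t₁, t₂). -/

import Mathlib

namespace StarCalc

/-- Finite types over a single ground type `G`, closed under `→` and `*`. -/
inductive Ty : Type where
  | ground : Ty
  | arrow : Ty → Ty → Ty
  | star : Ty → Ty
deriving DecidableEq, Repr

/-- The type `G → ⋯ → G → G` with `n` arrows, the type of an `n`-ary function symbol. -/
def fnTy : ℕ → Ty
  | 0 => .ground
  | n + 1 => .arrow .ground (fnTy n)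

/-- Terms of the star combinatory calculus over a family `F` of function symbols
(`F n` = the `n`-ary function symbols of the underlying first-order language). -/
inductive Term (F : ℕ → Type) : Ty → Type where
  | var (n : ℕ) (σ : Ty) : Term F σ
  | fn {n : ℕ} (f : F n) : Term F (fnTy n)
  | pi (σ τ : Ty) : Term F (σ.arrow (τ.arrow σ))
  | sigma (ρ σ τ : Ty) :
      Term F ((ρ.arrow (σ.arrow τ)).arrow ((ρ.arrow σ).arrow (ρ.arrow τ)))
  | sing (σ : Ty) : Term F (σ.arrow σ.star)
  | union (σ : Ty) : Term F (σ.star.arrow (σ.star.arrow σ.star))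
  | bigUnion (σ τ : Ty) : Term F (σ.star.arrow ((σ.arrow τ.star).arrow τ.star))
  | app {σ τ : Ty} (t : Term F (σ.arrow τ)) (q : Term F σ) : Term F τ

variable {F : ℕ → Type}

/-- One-step reduction: apply one of the conversions
`Σtqr ⇝ tr(qr)`, `Πtq ⇝ t`, `⋃(𝔰t)q ⇝ qt`, `⋃(∪tq)r ⇝ ∪(⋃tr)(⋃qr)`
to a subterm. -/
inductive Step : {σ : Ty} → Term F σ → Term F σ → Prop where
  | sigma {ρ σ τ : Ty} (t : Term F (ρ.arrow (σ.arrow τ))) (q : Term F (ρ.arrow σ))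
      (r : Term F ρ) :
      Step ((((Term.sigma ρ σ τ).app t).app q).app r) ((t.app r).app (q.app r))
  | pi {σ τ : Ty} (t : Term F σ) (q : Term F τ) :
      Step (((Term.pi σ τ).app t).app q) t
  | bigUnion_sing {σ τ : Ty} (t : Term F σ) (q : Term F (σ.arrow τ.star)) :
      Step (((Term.bigUnion σ τ).app ((Term.sing σ).app t)).app q) (q.app t)
  | bigUnion_union {σ τ : Ty} (t q : Term F σ.star) (r : Term F (σ.arrow τ.star)) :
      Step (((Term.bigUnion σ τ).app (((Term.union σ).app t).app q)).app r)
        (((Term.union τ).app (((Term.bigUnion σ τ).app t).app r)).app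
          (((Term.bigUnion σ τ).app q).app r))
  | app_left {σ τ : Ty} {t t' : Term F (σ.arrow τ)} (q : Term F σ) :
      Step t t' → Step (t.app q) (t'.app q)
  | app_right {σ τ : Ty} (t : Term F (σ.arrow τ)) {q q' : Term F σ} :
      Step q q' → Step (t.app q) (t.app q')

/-- `t ⪰ q` : `t` reduces to `q` by finitely many (possibly zero) one-step reductions. -/
def Reduces {σ : Ty} (t q : Term F σ) : Prop :=
  Relation.ReflTransGen Step t q

/-- A term is normal if no one-step reduction applies to it. -/
def Normal {σ : Ty} (t : Term F σ) : Prop :=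
  ∀ q : Term F σ, ¬ Step t q

/-- A term is strongly normalizable if there is no infinite chain of one-step
reductions starting from it. -/
def SN {σ : Ty} (t : Term F σ) : Prop :=
  ¬ ∃ f : ℕ → Term F σ, f 0 = t ∧ ∀ n : ℕ, Step (f n) (f (n + 1))

/-- A term is closed if it contains no variables. -/
def Term.ClosedT : {σ : Ty} → Term F σ → Prop
  | _, .var _ _ => False
  | _, .app t q => t.ClosedT ∧ q.ClosedT
  | _, _ => True

end StarCalc

namespace StarCalc
variable {F : ℕ → Type}

/-- A term of star type is set-like if it is constructed solely from terms of the
form `𝔰q` and the constant `∪`. -/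
inductive SetLike : {σ : Ty} → Term F σ.star → Prop where
  | sing {σ : Ty} (q : Term F σ) : SetLike ((Term.sing σ).app q)
  | union {σ : Ty} {t₁ t₂ : Term F σ.star} :
      SetLike t₁ → SetLike t₂ → SetLike (((Term.union σ).app t₁).app t₂)

end StarCalc

namespace StarCalc
variable {F : ℕ → Type}

theorem fnTy_ne_star (n : ℕ) (σ : Ty) : fnTy n ≠ σ.star := by
  cases n <;> simp [fnTy]

theorem exists_fnTy_of_arrow {σ τ : Ty} : (∃ n, σ.arrow τ = fnTy n) → ∃ n, τ = fnTy n
  | ⟨0, h⟩ => by simp [fnTy] at h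
  | ⟨n + 1, h⟩ => ⟨n, (Ty.arrow.inj h).2⟩

/-- The canonical forms of closed normal terms: set-like terms and constants other than function
symbols, applied to too few arguments to be converted. -/
inductive Canonical : {σ : Ty} → Term F σ → Prop where
  | setLike {σ : Ty} {t : Term F σ.star} : SetLike t → Canonical t
  | pi (σ τ : Ty) : Canonical (Term.pi σ τ)
  | piApp {σ τ : Ty} (t : Term F σ) : Canonical ((Term.pi σ τ).app t)
  | sigma (ρ σ τ : Ty) : Canonical (Term.sigma ρ σ τ)
  | sigmaApp {ρ σ τ : Ty} (t : Term F (ρ.arrow (σ.arrow τ))) :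
      Canonical ((Term.sigma ρ σ τ).app t)
  | sigmaAppApp {ρ σ τ : Ty} (t : Term F (ρ.arrow (σ.arrow τ))) (q : Term F (ρ.arrow σ)) :
      Canonical (((Term.sigma ρ σ τ).app t).app q)
  | sing (σ : Ty) : Canonical (Term.sing σ)
  | union (σ : Ty) : Canonical (Term.union σ)
  | unionApp {σ : Ty} {t : Term F σ.star} : SetLike t → Canonical ((Term.union σ).app t)
  | bigUnion (σ τ : Ty) : Canonical (Term.bigUnion σ τ)
  | bigUnionApp {σ τ : Ty} {t : Term F σ.star} :
      SetLike t → Canonical ((Term.bigUnion σ τ).app t)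

theorem Canonical.setLike_of_star {σ : Ty} {t : Term F σ.star} (h : Canonical t) :
    SetLike t := by
  cases h
  assumption

theorem SetLike.exists_step_bigUnion {σ τ : Ty} {t : Term F σ.star} (h : SetLike t)
    (q : Term F (σ.arrow τ.star)) : ∃ r, Step (((Term.bigUnion σ τ).app t).app q) r := by
  cases h with
  | sing t => exact ⟨_, .bigUnion_sing t q⟩
  | union => exact ⟨_, .bigUnion_union _ _ q⟩

/-- An application of a canonical form is reducible or canonical, provided that an argument of
star type is set-like. -/
theorem Canonical.app {σ τ : Ty} {t : Term F (σ.arrow τ)} (ht : Canonical t) {q : Term F σ}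
    (hq : (∃ n, σ = fnTy n) ∨ Canonical q) (hn : Normal (t.app q)) : Canonical (t.app q) := by
  have setLike_of {ρ : Ty} {r : Term F ρ.star} (hr : (∃ n, ρ.star = fnTy n) ∨ Canonical r) :
      SetLike r := by
    rcases hr with ⟨n, h⟩ | h
    · exact absurd h.symm (fnTy_ne_star n ρ)
    · exact h.setLike_of_star
  cases ht with
  | pi => exact .piApp q
  | piApp t => exact absurd (.pi t q) (hn _)
  | sigma => exact .sigmaApp q
  | sigmaApp t => exact .sigmaAppApp t q
  | sigmaAppApp t r => exact absurd (.sigma t r q) (hn _)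
  | sing => exact .setLike (.sing q)
  | union => exact .unionApp (setLike_of hq)
  | unionApp h => exact .setLike (.union h (setLike_of hq))
  | bigUnion => exact .bigUnionApp (setLike_of hq)
  | bigUnionApp h =>
    obtain ⟨r, hr⟩ := h.exists_step_bigUnion q
    exact absurd hr (hn r)

theorem Normal.exists_fnTy_or_canonical {σ : Ty} {t : Term F σ} (hc : t.ClosedT)
    (hn : Normal t) : (∃ n, σ = fnTy n) ∨ Canonical t := by
  induction t with
  | var => exact hc.elim
  | fn => exact .inl ⟨_, rfl⟩
  | pi => exact .inr (.pi _ _)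
  | sigma => exact .inr (.sigma _ _ _)
  | sing => exact .inr (.sing _)
  | union => exact .inr (.union _)
  | bigUnion => exact .inr (.bigUnion _ _)
  | app t q iht ihq =>
    have hq := ihq hc.2 fun r h => hn _ (.app_right t h)
    exact (iht hc.1 fun r h => hn _ (.app_left q h)).imp exists_fnTy_of_arrow
      fun ht => ht.app hq hn

end StarCalc

open StarCalc in
/-- If `t` is a normal closed term of star type in the star
combinatory calculus, then `t` is set-like. -/
theorem normal_closed_term_of_star_type_is_set_like (F : ℕ → Type) (c : F 0)
    {σ : Ty} (t : Term F σ.star) (hclosed : t.ClosedT) (hnormal : Normal t) :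
    SetLike t := by
  rcases hnormal.exists_fnTy_or_canonical hclosed with ⟨n, h⟩ | h
  · exact absurd h.symm (fnTy_ne_star n σ)
  · exact h.setLike_of_star
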